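/- Assume e/d is even and write e = 2m. Let b ∈ F_q^* and let a ∈ F_q^* NOT be a (2^d+1)-th power in F_q^* (i.e., a ≠ c^{2^d+1} for all c ∈ F_q^*). Then f(x) = a^{2^α}·x^{2^{2α}} + a·x is a permutation polynomial of F_q (i.e., x ↦ f(x) is a bijection of F_q), and if x₀ is the unique element of F_q satisfying f(x₀) = b^{2^α}, then S_α(a,b) = (−1)^{m/d}·2^m·χ₁(a·x₀^{2^α+1}). -/

import Mathlib

/-- In a finite cyclic group, a `k`-torsion element is an `n`-th power if `n * k` divides the
order of the group. -/
theorem IsCyclic.exists_pow_eq_of_pow_eq_one {G : Type*} [Group G] [Finite G] [IsCyclic G]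
    {n k : ℕ} (h : n * k ∣ Nat.card G) {y : G} (hy : y ^ k = 1) : ∃ c : G, c ^ n = y := by
  obtain ⟨g, hg⟩ := IsCyclic.exists_generator (α := G)
  obtain ⟨j, rfl⟩ := mem_powers_iff_mem_zpowers.2 (hg y)
  have hk : 0 < k := Nat.pos_of_mul_pos_left (Nat.pos_of_dvd_of_pos h Nat.card_pos)
  simp only at hy ⊢
  rw [← pow_mul, ← orderOf_dvd_iff_pow_eq_one, orderOf_eq_card_of_forall_mem_zpowers hg] at hy
  obtain ⟨i, rfl⟩ := Nat.dvd_of_mul_dvd_mul_right hk (h.trans hy)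
  exact ⟨g ^ i, by rw [← pow_mul, mul_comm]⟩

/-- If `n` divides both `N` and the order of a finite cyclic group, then `n` divides every sum
over the group of an integer-valued function of the `N`-th power. -/
theorem IsCyclic.dvd_sum_comp_pow {G : Type*} [CommGroup G] [Fintype G] [IsCyclic G]
    {n N : ℕ} (hn : n ∣ Nat.card G) (hN : n ∣ N) (g : G → ℤ) : (n : ℤ) ∣ ∑ u : G, g (u ^ N) := by
  classical
  obtain ⟨k, rfl⟩ := hN
  rw [← Finset.sum_fiberwise (s := Finset.univ) (g := fun u : G ↦ u ^ n)]
  refine Finset.dvd_sum fun v _ ↦ ?_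
  have hconst : ∀ u ∈ Finset.univ.filter (fun u : G ↦ u ^ n = v), g (u ^ (n * k)) = g (v ^ k) := by
    intro u hu
    rw [pow_mul, (Finset.mem_filter.1 hu).2]
  rw [Finset.sum_congr rfl hconst, Finset.sum_const, nsmul_eq_mul]
  refine Dvd.dvd.mul_right (Int.natCast_dvd_natCast.2 ?_) _
  by_cases hv : v ∈ Set.range (powMonoidHom n : G →* G)
  · have h := MonoidHom.card_fiber_eq_of_mem_range (powMonoidHom n : G →* G) hv
      ⟨1, map_one _⟩
    simp only [powMonoidHom_apply] at h
    rw [h]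
    have hker := IsCyclic.card_powMonoidHom_ker G n
    rw [Nat.gcd_eq_right hn] at hker
    rw [← Fintype.card_subtype, ← Nat.card_eq_fintype_card]
    exact hker.symm.dvd
  · rw [Finset.filter_false_of_mem, Finset.card_empty]
    · exact dvd_zero n
    · rintro u - rfl
      exact hv ⟨u, rfl⟩

section FrobeniusInvariant

variable {F : Type*} [Field F] [Fintype F] [CharP F 2]

/-- The linearised polynomial map attached to the quadratic form `a x ^ (2 ^ α + 1)` is injective
when `a` is not a `(2 ^ d + 1)`-th power. -/
theorem eq_zero_of_linearized_eq_zero {e α d : ℕ} (hF : Fintype.card F = 2 ^ e)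
    (hd : d = Nat.gcd e α) (hα : 2 ^ d + 1 ∣ 2 ^ α + 1)
    (he : (2 ^ d + 1) * (2 ^ d - 1) ∣ 2 ^ e - 1) {a : F} (ha : a ≠ 0)
    (ha' : ∀ c : F, c ≠ 0 → a ≠ c ^ (2 ^ d + 1)) {x : F}
    (hx : a ^ 2 ^ α * x ^ 2 ^ (2 * α) + a * x = 0) : x = 0 := by
  by_contra hx0
  have hcard : Nat.card Fˣ = 2 ^ e - 1 := by
    rw [Nat.card_units, Nat.card_eq_fintype_card, hF]
  set y : F := a * x ^ (2 ^ α + 1) with hy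
  have hy0 : y ≠ 0 := mul_ne_zero ha (pow_ne_zero _ hx0)
  have hfix : y ^ 2 ^ α = y := by
    have h : a ^ 2 ^ α * x ^ 2 ^ (2 * α) = a * x := by
      rwa [CharTwo.add_eq_zero] at hx
    calc y ^ 2 ^ α = a ^ 2 ^ α * x ^ 2 ^ (2 * α) * x ^ 2 ^ α := by
          rw [hy]; ring
      _ = y := by rw [h, hy]; ring
  have hpow : ∀ u : Fˣ, (u : F) ^ 2 ^ α = u → u ^ (2 ^ α - 1) = 1 := by
    intro u hu
    have h1 : u ^ (2 ^ α - 1) * u = 1 * u := by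
      rw [← pow_succ, Nat.sub_add_cancel Nat.one_le_two_pow, one_mul]
      exact Units.ext hu
    exact mul_right_cancel h1
  have h1 := hpow (Units.mk0 y hy0) hfix
  have h2 : (Units.mk0 y hy0) ^ (2 ^ e - 1) = 1 := by
    rw [← hcard]; exact pow_card_eq_one'
  have h3 : (Units.mk0 y hy0) ^ (2 ^ d - 1) = 1 := by
    rw [hd, ← Nat.pow_sub_one_gcd_pow_sub_one]
    exact pow_gcd_eq_one.2 ⟨h2, h1⟩
  obtain ⟨c, hc⟩ := IsCyclic.exists_pow_eq_of_pow_eq_one (hcard ▸ he) h3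
  obtain ⟨k, hk⟩ := hα
  have hc' : (c : F) ^ (2 ^ d + 1) = y := by simpa using congrArg Units.val hc
  refine ha' (c / x ^ k) (div_ne_zero c.ne_zero (pow_ne_zero _ hx0)) ?_
  rw [div_pow, hc', hy, hk, ← pow_mul, mul_comm k, mul_div_cancel_right₀ _ (pow_ne_zero _ hx0)]

variable {ψ : AddChar F ℤ} (hψ : ∀ x, ψ (x ^ 2) = ψ x)

omit [Fintype F] [CharP F 2] in
include hψ in
theorem AddChar.map_pow_two_pow (x : F) (k : ℕ) : ψ (x ^ 2 ^ k) = ψ x := by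
  induction k with
  | zero => simp
  | succ k ih => rw [pow_succ, pow_mul, hψ, ih]

omit [Fintype F] in
theorem AddChar.mul_self_eq_one_of_charTwo (x : F) : ψ x * ψ x = 1 := by
  rw [← AddChar.map_add_eq_mul, CharTwo.add_self_eq_zero, AddChar.map_zero_eq_one]

omit [Fintype F] in
include hψ in
theorem AddChar.map_mul_add_pow (a x z : F) (α : ℕ) :
    ψ (a * (x + z) ^ (2 ^ α + 1)) = ψ (a * x ^ (2 ^ α + 1)) * ψ (a * z ^ (2 ^ α + 1)) *
      ψ (x ^ 2 ^ α * (a ^ 2 ^ α * z ^ 2 ^ (2 * α) + a * z)) := by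
  have h1 : a * (x + z) ^ (2 ^ α + 1) = a * x ^ (2 ^ α + 1) + a * z ^ (2 ^ α + 1) +
      (a * x * z ^ 2 ^ α + x ^ 2 ^ α * (a * z)) := by
    rw [pow_succ, add_pow_char_pow]; ring
  have h2 : x ^ 2 ^ α * (a ^ 2 ^ α * z ^ 2 ^ (2 * α)) = (a * x * z ^ 2 ^ α) ^ 2 ^ α := by ring
  rw [h1, mul_add, h2]
  simp only [AddChar.map_add_eq_mul, AddChar.map_pow_two_pow hψ]

theorem AddChar.sum_pow_mul (hne : ψ ≠ 1) [DecidableEq F] (c : F) (k : ℕ) :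
    ∑ x : F, ψ (x ^ 2 ^ k * c) = if c = 0 then (Fintype.card F : ℤ) else 0 := by
  have h := AddChar.sum_mulShift c (AddChar.IsPrimitive.of_ne_one hne)
  rw [Nat.cast_ite, Nat.cast_zero] at h
  rw [← h]
  exact (Equiv.sum_comp (iterateFrobeniusEquiv F 2 k).toEquiv (fun x ↦ ψ (x * c)) :)

include hψ in
theorem AddChar.sq_sum_quadratic (hne : ψ ≠ 1) {a : F} {α : ℕ}
    (hker : ∀ x : F, a ^ 2 ^ α * x ^ 2 ^ (2 * α) + a * x = 0 → x = 0) :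
    (∑ x : F, ψ (a * x ^ (2 ^ α + 1))) ^ 2 = Fintype.card F := by
  classical
  calc (∑ x : F, ψ (a * x ^ (2 ^ α + 1))) ^ 2
      = ∑ x : F, ∑ z : F, ψ (a * x ^ (2 ^ α + 1)) * ψ (a * (x + z) ^ (2 ^ α + 1)) := by
        rw [sq, Finset.sum_mul]
        refine Finset.sum_congr rfl fun x _ ↦ ?_
        rw [Finset.mul_sum]
        exact (Equiv.sum_comp (Equiv.addLeft x)
          (fun y ↦ ψ (a * x ^ (2 ^ α + 1)) * ψ (a * y ^ (2 ^ α + 1)))).symm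
    _ = ∑ x : F, ∑ z : F, ψ (a * z ^ (2 ^ α + 1)) *
          ψ (x ^ 2 ^ α * (a ^ 2 ^ α * z ^ 2 ^ (2 * α) + a * z)) := by
        refine Finset.sum_congr rfl fun x _ ↦ Finset.sum_congr rfl fun z _ ↦ ?_
        rw [AddChar.map_mul_add_pow hψ, ← mul_assoc, ← mul_assoc,
          AddChar.mul_self_eq_one_of_charTwo, one_mul]
    _ = ∑ z : F, if z = 0 then (Fintype.card F : ℤ) else 0 := by
        rw [Finset.sum_comm]
        refine Finset.sum_congr rfl fun z _ ↦ ?_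
        rw [← Finset.mul_sum, AddChar.sum_pow_mul hne]
        by_cases hz : z = 0
        · simp [hz]
        · rw [if_neg hz, if_neg fun h ↦ hz (hker z h), mul_zero]
    _ = Fintype.card F := by simp

include hψ in
/-- Completing the square in the exponential sum. -/
theorem AddChar.sum_quadratic_add_linear {a b x₀ : F} {α : ℕ}
    (hx₀ : a ^ 2 ^ α * x₀ ^ 2 ^ (2 * α) + a * x₀ = b ^ 2 ^ α) :
    ∑ x : F, ψ (a * x ^ (2 ^ α + 1) + b * x) =
      (∑ x : F, ψ (a * x ^ (2 ^ α + 1))) * ψ (a * x₀ ^ (2 ^ α + 1)) := by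
  rw [← Equiv.sum_comp (Equiv.addRight x₀) (fun x ↦ ψ (a * x ^ (2 ^ α + 1))), Finset.sum_mul]
  refine Finset.sum_congr rfl fun x _ ↦ ?_
  rw [Equiv.coe_addRight, AddChar.map_mul_add_pow hψ, hx₀, ← mul_pow,
    AddChar.map_pow_two_pow hψ, AddChar.map_add_eq_mul, mul_comm b]
  linear_combination (-(ψ (a * x ^ (2 ^ α + 1)) * ψ (x * b))) *
    AddChar.mul_self_eq_one_of_charTwo (ψ := ψ) (a * x₀ ^ (2 ^ α + 1))

omit [CharP F 2] in
theorem dvd_sum_comp_pow_sub {n N : ℕ} (hn : n ∣ Fintype.card F - 1) (hN : n ∣ N)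
    (hN0 : N ≠ 0) (g : F → ℤ) : (n : ℤ) ∣ ∑ x : F, g (x ^ N) - g 0 := by
  classical
  have h : (n : ℤ) ∣ ∑ u : Fˣ, g ((u ^ N : Fˣ) : F) :=
    IsCyclic.dvd_sum_comp_pow (by rwa [Nat.card_units, Nat.card_eq_fintype_card]) hN
      (fun u : Fˣ ↦ g u)
  rw [Fintype.sum_eq_add_sum_subtype_ne _ (0 : F), zero_pow hN0, add_sub_cancel_left,
    ← Equiv.sum_comp unitsEquivNeZero]
  simpa using h

end FrobeniusInvariant

theorem Int.eq_neg_one_pow_mul_of_sq_eq {s : ℤ} {d k : ℕ} (hd : 0 < d)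
    (hs : s ^ 2 = ((2 : ℤ) ^ (d * k)) ^ 2) (hdvd : (2 : ℤ) ^ d + 1 ∣ s - 1) :
    s = (-1) ^ k * 2 ^ (d * k) := by
  have hlt : (2 : ℤ) < 2 ^ d + 1 := by
    have : (2 : ℤ) ^ 1 ≤ 2 ^ d := pow_le_pow_right₀ (by norm_num) hd
    linarith
  have hnot : ¬ (2 : ℤ) ^ d + 1 ∣ 2 := fun h ↦ absurd (Int.le_of_dvd two_pos h) hlt.not_ge
  have h : (2 : ℤ) ^ d + 1 ∣ 2 ^ (d * k) - (-1) ^ k := by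
    simpa [pow_mul] using sub_dvd_pow_sub_pow ((2 : ℤ) ^ d) (-1) k
  rcases neg_one_pow_eq_or ℤ k with hk | hk <;> rw [hk] at h ⊢ <;>
    rcases sq_eq_sq_iff_eq_or_eq_neg.1 hs with rfl | rfl
  · ring
  · exact (hnot (by simpa using dvd_add h hdvd |>.neg_right)).elim
  · exact (hnot (by simpa using dvd_sub h hdvd)).elim
  · ring

/-- The absolute trace of a field of order `2 ^ e`, as a sum of Frobenius powers, takes a nonzero
value. -/
theorem FiniteField.exists_sum_pow_two_pow_ne_zero {F : Type*} [Field F] [Fintype F] {e : ℕ}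
    (hF : Fintype.card F = 2 ^ e) : ∃ x : F, ∑ i ∈ Finset.range e, x ^ 2 ^ i ≠ 0 := by
  have : Fact (Nat.Prime 2) := ⟨Nat.prime_two⟩
  have : CharP F 2 := charP_of_card_eq_prime_pow hF
  let _ : Algebra (ZMod 2) F := ZMod.algebra F 2
  have hrank : Module.finrank (ZMod 2) F = e := by
    have h := Module.card_eq_pow_finrank (K := ZMod 2) (V := F)
    rw [hF, ZMod.card] at h
    exact (Nat.pow_right_injective le_rfl h).symm
  obtain ⟨x, hx⟩ := Algebra.trace_surjective (ZMod 2) F 1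
  refine ⟨x, ?_⟩
  have h := FiniteField.algebraMap_trace_eq_sum_pow (ZMod 2) F x
  rw [hx, map_one, hrank, Nat.card_zmod] at h
  exact h ▸ one_ne_zero

/-- The canonical additive character of a field of order `2 ^ e`. -/
theorem FiniteField.exists_addChar_eq_ite_trace {F : Type*} [Field F] [Fintype F] [DecidableEq F]
    {e : ℕ} (hF : Fintype.card F = 2 ^ e) :
    ∃ ψ : AddChar F ℤ, (∀ x, ψ x = if ∑ i ∈ Finset.range e, x ^ 2 ^ i = 0 then 1 else -1) ∧
      ψ ≠ 1 ∧ ∀ x, ψ (x ^ 2) = ψ x := by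
  have : Fact (Nat.Prime 2) := ⟨Nat.prime_two⟩
  have : CharP F 2 := charP_of_card_eq_prime_pow hF
  set T : F → F := fun x ↦ ∑ i ∈ Finset.range e, x ^ 2 ^ i with hT
  have hadd : ∀ x y, T (x + y) = T x + T y := fun x y ↦ by
    simp only [hT, add_pow_char_pow, Finset.sum_add_distrib]
  have hsq : ∀ x, T (x ^ 2) = T x := fun x ↦ by
    have h1 := Finset.sum_range_succ (fun i ↦ x ^ 2 ^ i) e
    rw [Finset.sum_range_succ', ← hF, FiniteField.pow_card, pow_zero, pow_one] at h1
    simpa only [hT, ← pow_mul, ← pow_succ'] using add_right_cancel h1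
  have hT01 : ∀ x, T x = 0 ∨ T x = 1 := fun x ↦ by
    have h : T x ^ 2 = T x := by
      refine Eq.trans ?_ (hsq x)
      simp only [hT, sum_pow_char, ← pow_mul, mul_comm 2]
    rw [sq] at h
    by_cases h0 : T x = 0
    · exact .inl h0
    · exact .inr (mul_left_cancel₀ h0 (by rw [h, mul_one]))
  refine ⟨⟨fun x ↦ if T x = 0 then 1 else -1, ?_, ?_⟩, fun x ↦ rfl, ?_, fun x ↦ ?_⟩
  · have : T 0 = 0 := by simp [hT]
    simp [this]
  · intro x y
    rcases hT01 x with hx | hx <;> rcases hT01 y with hy | hy <;>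
      simp [hadd, hx, hy, CharTwo.add_self_eq_zero]
  · intro h
    obtain ⟨x, hx⟩ := FiniteField.exists_sum_pow_two_pow_ne_zero hF
    have h2 := DFunLike.congr_fun h x
    simp [hT, hx] at h2
  · simp [hsq]


/-- If `e/d` is even, `e = 2m`, `b ∈ F_q^*` and `a ∈ F_q^*` is not a `(2^d+1)`-th power,
then `f(x) = a^{2^α} x^{2^{2α}} + a x` is a permutation polynomial of `F_q`, and the unique
`x₀` with `f(x₀) = b^{2^α}` satisfies `S_α(a,b) = (-1)^{m/d} 2^m χ₁(a x₀^{2^α+1})`. -/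
theorem stmt_18
    (e α : ℕ) (he : 0 < e) (hα : 0 < α)
    (d m : ℕ) (hd : d = Nat.gcd e α) (hm : e = 2 * m)
    (heven : Even (e / d))
    (F : Type) [Field F] [Fintype F] [DecidableEq F]
    (hF : Fintype.card F = 2 ^ e)
    (Tr : F → F) (hTr : ∀ x, Tr x = ∑ i ∈ Finset.range e, x ^ 2 ^ i)
    (χ : F → ℤ) (hχ : ∀ x, χ x = if Tr x = 0 then 1 else -1)
    (S : F → F → ℤ)
    (hS : ∀ a b : F, S a b = ∑ x : F, χ (a * x ^ (2 ^ α + 1) + b * x))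
    (a b : F) (ha : a ≠ 0) (hb : b ≠ 0)
    (ha' : ∀ c : F, c ≠ 0 → a ≠ c ^ (2 ^ d + 1))
    (f : F → F) (hf : ∀ x, f x = a ^ 2 ^ α * x ^ 2 ^ (2 * α) + a * x) :
    Function.Bijective f ∧
    (∀ x₀ : F, f x₀ = b ^ 2 ^ α →
      S a b = (-1 : ℤ) ^ (m / d) * 2 ^ m * χ (a * x₀ ^ (2 ^ α + 1))) := by
  have : Fact (Nat.Prime 2) := ⟨Nat.prime_two⟩
  have : CharP F 2 := charP_of_card_eq_prime_pow hF
  have hd0 : 0 < d := hd ▸ Nat.gcd_pos_of_pos_left _ he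
  obtain ⟨k, hk⟩ : ∃ k, e = 2 * d * k := by
    obtain ⟨k, hk⟩ := heven
    have h := Nat.div_mul_cancel (hd ▸ Nat.gcd_dvd_left e α : d ∣ e)
    exact ⟨k, by rw [← h, hk]; ring⟩
  have hmk : m = d * k := by linarith
  have hαdvd : 2 ^ d + 1 ∣ 2 ^ α + 1 := by
    obtain ⟨j, hj⟩ : d ∣ α := hd ▸ Nat.gcd_dvd_right e α
    have hodd : Odd j := by
      by_contra hj'
      obtain ⟨i, hi⟩ := even_iff_two_dvd.1 (Nat.not_odd_iff_even.1 hj')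
      have h2 : 2 * d ∣ Nat.gcd e α :=
        Nat.dvd_gcd ⟨k, hk⟩ ⟨i, by rw [hj, hi]; ring⟩
      rw [← hd] at h2
      have := Nat.le_of_dvd hd0 h2
      omega
    simpa [hj, pow_mul] using Odd.nat_add_dvd_pow_add_pow (2 ^ d) 1 hodd
  have hedvd : (2 ^ d + 1) * (2 ^ d - 1) ∣ 2 ^ e - 1 := by
    have h1 : (2 ^ d + 1) * (2 ^ d - 1) = 2 ^ (2 * d) - 1 := by
      rw [← Nat.sq_sub_sq, ← pow_mul, mul_comm d, one_pow]
    rw [h1, hk, pow_mul 2 (2 * d) k]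
    simpa using Nat.sub_dvd_pow_sub_pow (2 ^ (2 * d)) 1 k
  have hker : ∀ x : F, a ^ 2 ^ α * x ^ 2 ^ (2 * α) + a * x = 0 → x = 0 := fun x hx ↦
    eq_zero_of_linearized_eq_zero hF hd hαdvd hedvd ha ha' hx
  refine ⟨Finite.injective_iff_bijective.1 fun x y hxy ↦ ?_, fun x₀ hx₀ ↦ ?_⟩
  · refine sub_eq_zero.1 (hker (x - y) ?_)
    rw [hf, hf] at hxy
    rw [sub_pow_char_pow]
    linear_combination hxy
  · obtain ⟨ψ, hψ, hne, hsq⟩ := FiniteField.exists_addChar_eq_ite_trace hF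
    have hχψ : ∀ x, χ x = ψ x := fun x ↦ by rw [hχ, hTr, hψ]
    rw [hf] at hx₀
    rw [hS]
    simp only [hχψ]
    rw [AddChar.sum_quadratic_add_linear hsq hx₀, hmk, Nat.mul_div_cancel_left k hd0]
    congr 1
    refine Int.eq_neg_one_pow_mul_of_sq_eq hd0 ?_ ?_
    · rw [AddChar.sq_sum_quadratic hsq hne hker, hF, hm, hmk]
      push_cast
      ring
    · have h := dvd_sum_comp_pow_sub (F := F) (n := 2 ^ d + 1)
        (hF ▸ (Dvd.intro _ rfl).trans hedvd) hαdvd (Nat.succ_ne_zero _) (fun y ↦ ψ (a * y))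
      simpa using h
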